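/- arXiv:math/0501185 — 5 statements merged into one kernel-verified Lean document; each statement's English description precedes it below -/
import Mathlib

section
/- Let μ be an admissible probability measure on ℝ with second characteristic ψ, and let Λ(μ) = {t > 0 : exp(tψ) is the characteristic function of some probability measure on ℝ}. Then Λ(μ) is closed in (0,∞): if (t_k) is a sequence in Λ(μ) converging to some t > 0, then t ∈ Λ(μ). -/
open MeasureTheory

/-- The characteristic function of a measure on `ℝ`. -/
noncomputable def charFunR (μ : Measure ℝ) (y : ℝ) : ℂ :=
  ∫ x, Complex.exp (Complex.I * y * x) ∂μ

/-- `Λ(μ)` for an admissible measure with second characteristic `ψ`: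
the set of `t > 0` such that `exp (t ψ)` is a characteristic function. -/
def Lam (ψ : ℝ → ℂ) : Set ℝ :=
  {t | 0 < t ∧ ∃ ν : Measure ℝ, IsProbabilityMeasure ν ∧
    ∀ y, charFunR ν y = Complex.exp (t * ψ y)}

open Filter Topology in
/-- A continuity theorem: the pointwise limit of characteristic functions of probability measures
is a characteristic function as soon as it is continuous at `0`. -/
lemma exists_charFun_eq_of_tendsto {E : Type*} [NormedAddCommGroup E] [InnerProductSpace ℝ E]
    [FiniteDimensional ℝ E] [MeasurableSpace E] [BorelSpace E] {ν : ℕ → ProbabilityMeasure E}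
    {f : E → ℂ} (hf : ContinuousAt f 0)
    (h : ∀ y, Tendsto (fun n ↦ charFun (ν n : Measure E) y) atTop (𝓝 (f y))) :
    ∃ ν₀ : ProbabilityMeasure E, charFun (ν₀ : Measure E) = f := by
  have tight : IsTightMeasureSet {(ν n : Measure E) | n} :=
    isTightMeasureSet_of_tendsto_charFun hf h
  have compact : IsCompact (closure (Set.range ν)) :=
    isCompact_closure_of_isTightMeasureSet (by simpa using tight)
  obtain ⟨ν₀, -, hν₀ : Tendsto ν (hyperfilter ℕ : Filter ℕ) (𝓝 ν₀)⟩ :=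
    compact.ultrafilter_le_nhds ((hyperfilter ℕ).map ν)
      (.trans (by simp) (monotone_principal subset_closure))
  refine ⟨ν₀, funext fun y ↦ tendsto_nhds_unique ?_ ((h y).mono_left Nat.hyperfilter_le_atTop)⟩
  rw [ProbabilityMeasure.tendsto_iff_forall_integral_rclike_tendsto ℂ] at hν₀
  simp_rw [charFun_eq_integral_innerProbChar]
  exact hν₀ (BoundedContinuousFunction.innerProbChar y)

lemma charFunR_eq_charFun (ν : Measure ℝ) (y : ℝ) : charFunR ν y = charFun ν y := by
  rw [charFunR, charFun_apply_real]
  congr! 3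
  ring

/-- `Λ(μ)` is closed in `(0,∞)`: the limit of a sequence in `Λ(μ)` converging
to a positive number again lies in `Λ(μ)`. -/
theorem Lam_closed (μ : Measure ℝ) [IsProbabilityMeasure μ]
    (ψ : ℝ → ℂ) (hψc : Continuous ψ) (hψ0 : ψ 0 = 0)
    (hμψ : ∀ y, charFunR μ y = Complex.exp (ψ y))
    (t : ℕ → ℝ) (ht : ∀ k, t k ∈ Lam ψ)
    (t₀ : ℝ) (ht₀ : 0 < t₀)
    (hlim : Filter.Tendsto t Filter.atTop (nhds t₀)) :
    t₀ ∈ Lam ψ := by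
  choose ν hν hνψ using fun k ↦ (ht k).2
  obtain ⟨ν₀, hν₀⟩ := exists_charFun_eq_of_tendsto (ν := fun k ↦ ⟨ν k, hν k⟩)
    (f := fun y ↦ Complex.exp (t₀ * ψ y)) (by fun_prop) fun y ↦ by
      simp_rw [ProbabilityMeasure.coe_mk, ← charFunR_eq_charFun, hνψ]
      exact (Complex.continuous_exp.tendsto _).comp
        (((Complex.continuous_ofReal.tendsto _).comp hlim).mul_const _)
  exact ⟨ht₀, ν₀, inferInstance, fun y ↦ by rw [charFunR_eq_charFun, hν₀]⟩
end

section
/- Let μ be an admissible probability measure on ℤ with second characteristic ψ : 𝕋 → ℂ, let n be a positive integer, and suppose ν is a probability measure on ℤ whose n-fold convolution ν * ⋯ * ν (n times) equals μ. Then ν is admissible with second characteristic ψ/n, i.e., ν̂(z) = exp(ψ(z)/n) for all z ∈ 𝕋; in particular, ν is the unique probability measure on ℤ whose n-fold convolution equals μ. (Theorem 2.2 for G = ℤ, where the dual group 𝕋 has nontrivial fundamental group.) -/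
open MeasureTheory

/-- The `n`-fold convolution power of a measure (`convPow ν n = ν ∗ ⋯ ∗ ν`,
`n` times, with the convention that the `0`-th power is `δ₀`). -/
noncomputable def convPow {G : Type*} [AddMonoid G] [MeasurableSpace G]
    (ν : Measure G) : ℕ → Measure G
  | 0 => Measure.dirac 0
  | k + 1 => (convPow ν k).conv ν

/-- The characteristic function of a measure `μ` on `ℤ`, as a function on the
unit circle: `μ̂(z) = ∑_{k ∈ ℤ} μ({k}) z^k = ∫ z^k dμ(k)`. -/
noncomputable def charFunZ (μ : Measure ℤ) (z : Circle) : ℂ :=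
  ∫ k, (z : ℂ) ^ k ∂μ

lemma integrable_circle_zpow (ν : Measure ℤ) [IsFiniteMeasure ν] (z : Circle) :
    Integrable (fun k : ℤ => (z : ℂ) ^ k) ν :=
  .of_bound (C := 1) (measurable_of_countable _).aestronglyMeasurable
    (.of_forall fun k => by rw [norm_zpow, Circle.norm_coe, one_zpow])

lemma charFunZ_conv (μ ν : Measure ℤ) [IsFiniteMeasure μ] [IsFiniteMeasure ν] (z : Circle) :
    charFunZ (μ.conv ν) z = charFunZ μ z * charFunZ ν z := by
  unfold charFunZ
  rw [integral_conv (integrable_circle_zpow _ z)]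
  simp only [zpow_add₀ (Circle.coe_ne_zero z), integral_const_mul, integral_mul_const]

lemma isProbabilityMeasure_convPow (ν : Measure ℤ) [IsProbabilityMeasure ν] (n : ℕ) :
    IsProbabilityMeasure (convPow ν n) := by
  induction n with
  | zero => unfold convPow; infer_instance
  | succ n ih => unfold convPow; infer_instance

lemma charFunZ_convPow (ν : Measure ℤ) [IsProbabilityMeasure ν] (n : ℕ) (z : Circle) :
    charFunZ (convPow ν n) z = charFunZ ν z ^ n := by
  induction n with
  | zero => simp [charFunZ, convPow]
  | succ n ih =>
    have := isProbabilityMeasure_convPow ν n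
    rw [convPow, charFunZ_conv, ih, pow_succ]

lemma continuous_charFunZ (ν : Measure ℤ) [IsFiniteMeasure ν] : Continuous (charFunZ ν) := by
  refine continuous_of_dominated (bound := fun _ => 1)
    (fun z => (integrable_circle_zpow ν z).aestronglyMeasurable)
    (fun z => .of_forall fun k => by rw [norm_zpow, Circle.norm_coe, one_zpow]) (by simp) ?_
  exact .of_forall fun k => continuous_subtype_val.zpow₀ k fun z => .inl (Circle.coe_ne_zero z)

lemma charFunZ_one (ν : Measure ℤ) [IsProbabilityMeasure ν] : charFunZ ν 1 = 1 := by
  simp [charFunZ]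

lemma charFun_map_intCast (ν : Measure ℤ) (t : ℝ) :
    charFun (ν.map (fun k : ℤ => (k : ℝ))) t = charFunZ ν (Circle.exp t) := by
  rw [charFun_apply_real, integral_map (measurable_of_countable _).aemeasurable (by fun_prop)]
  refine integral_congr_ae (.of_forall fun k => ?_)
  simp only [Circle.coe_exp, ← Complex.exp_int_mul]
  congr 1
  push_cast
  ring

lemma ext_of_charFunZ {μ ν : Measure ℤ} [IsFiniteMeasure μ] [IsFiniteMeasure ν]
    (h : charFunZ μ = charFunZ ν) : μ = ν := by
  have hmap : μ.map (fun k : ℤ => (k : ℝ)) = ν.map (fun k : ℤ => (k : ℝ)) :=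
    Measure.ext_of_charFun (funext fun t => by simp only [charFun_map_intCast, h])
  have he : MeasurableEmbedding (fun k : ℤ => (k : ℝ)) :=
    Int.isClosedEmbedding_coe_real.measurableEmbedding
  rw [← he.comap_map μ, hmap, he.comap_map]

/-- A continuous function on the circle with value `1` at `1` whose `n`-th power is `1` is
identically `1`. -/
lemma Circle.eq_one_of_pow_eq_one {g : Circle → ℂ} (hg : Continuous g) {n : ℕ} (hn : 0 < n)
    (hpow : ∀ z, g z ^ n = 1) (hone : g 1 = 1) (z : Circle) : g z = 1 := by
  have hfin : {w : ℂ | w ^ n = 1}.Finite := by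
    refine (Polynomial.nthRoots n (1 : ℂ)).toFinset.finite_toSet.subset fun w hw => ?_
    simpa [Polynomial.mem_nthRoots hn] using hw
  have := hfin.isDiscrete
  obtain ⟨t, rfl⟩ := Circle.exp_surjective z
  have key := isPreconnected_univ.constant_of_mapsTo (S := (Set.univ : Set ℝ))
    (f := fun s => g (Circle.exp s)) this
    (hg.comp Circle.exp.continuous).continuousOn (fun s _ => hpow _)
    (Set.mem_univ t) (Set.mem_univ 0)
  simpa [hone] using key

lemma charFunZ_eq_exp_of_convPow_eq {μ ν : Measure ℤ} [IsProbabilityMeasure ν]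
    {ψ : Circle → ℂ} (hψc : Continuous ψ) (hψ0 : ψ 1 = 0)
    (hμψ : ∀ z, charFunZ μ z = Complex.exp (ψ z)) {n : ℕ} (hn : 0 < n)
    (hν : convPow ν n = μ) (z : Circle) : charFunZ ν z = Complex.exp (ψ z / n) := by
  have hn' : (n : ℂ) ≠ 0 := by exact_mod_cast hn.ne'
  have h := Circle.eq_one_of_pow_eq_one (g := fun z => charFunZ ν z / Complex.exp (ψ z / n))
    ((continuous_charFunZ ν).div (by fun_prop) fun z => Complex.exp_ne_zero _) hn
    (fun z => by
      rw [div_pow, ← charFunZ_convPow, hν, hμψ, ← Complex.exp_nat_mul, mul_div_cancel₀ _ hn',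
        div_self (Complex.exp_ne_zero _)])
    (by simp [charFunZ_one, hψ0]) z
  exact (div_eq_one_iff_eq (Complex.exp_ne_zero _)).mp h

/-- Theorem 2.2 for `G = ℤ`: an `n`-th convolution root of an admissible
probability measure `μ` on `ℤ` with second characteristic `ψ : 𝕋 → ℂ` is
admissible with second characteristic `ψ/n`, and is the unique `n`-th root. -/
theorem conv_root_admissible_unique_int
    (μ : Measure ℤ) [IsProbabilityMeasure μ]
    (ψ : Circle → ℂ) (hψc : Continuous ψ) (hψ0 : ψ 1 = 0)
    (hμψ : ∀ z, charFunZ μ z = Complex.exp (ψ z))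
    (n : ℕ) (hn : 0 < n)
    (ν : Measure ℤ) [IsProbabilityMeasure ν]
    (hν : convPow ν n = μ) :
    (∀ z, charFunZ ν z = Complex.exp (ψ z / n)) ∧
      ∀ ν' : Measure ℤ, IsProbabilityMeasure ν' →
        convPow ν' n = μ → ν' = ν := by
  have root {ρ : Measure ℤ} [IsProbabilityMeasure ρ] (hρ : convPow ρ n = μ) (z : Circle) :
      charFunZ ρ z = Complex.exp (ψ z / n) :=
    charFunZ_eq_exp_of_convPow_eq hψc hψ0 hμψ hn hρ z
  refine ⟨root hν, fun ν' _ hν' => ext_of_charFunZ (funext fun z => ?_)⟩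
  rw [root hν', root hν]
end

section
/- Let μ be a probability measure on ℤ whose characteristic function μ̂ is nonvanishing on 𝕋, with winding number w ∈ ℤ around 0, and assume w ≠ 0. Let m, n be coprime positive integers and ν a probability measure on ℤ with (ν̂(z))ⁿ = (μ̂(z))ᵐ for all z ∈ 𝕋; then ν̂ is nonvanishing, and its winding number w_ν satisfies n·w_ν = m·w. Consequently m/n = w_ν/w, so that m/n ∈ {k/|w| : k a positive integer} and m/n ≥ 1/|w|. (Theorem 3.1(ii),(iii) for G = ℤ.) -/
open MeasureTheory

/-- A function on `[0, 1]` that is continuous and takes values in `2πiℤ` is constant. -/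
theorem eq_of_continuousOn_of_exp_eq_one {g : ℝ → ℂ} (hg : ContinuousOn g (Set.Icc 0 1))
    (h : ∀ s ∈ Set.Icc (0 : ℝ) 1, Complex.exp (g s) = 1) : g 1 = g 0 := by
  have hpi : (2 * Real.pi * Complex.I : ℂ) ≠ 0 := Complex.two_pi_I_ne_zero
  have hdisc : IsDiscrete (Set.range ((↑) : ℤ → ℝ)) :=
    Int.isClosedEmbedding_coe_real.isEmbedding.isDiscrete_range
  have hre : ContinuousOn (fun s => (g s / (2 * Real.pi * Complex.I)).re) (Set.Icc 0 1) :=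
    Complex.continuous_re.comp_continuousOn (hg.div_const _)
  have hmaps : Set.MapsTo (fun s => (g s / (2 * Real.pi * Complex.I)).re) (Set.Icc 0 1)
      (Set.range ((↑) : ℤ → ℝ)) := by
    intro s hs
    obtain ⟨k, hk⟩ := Complex.exp_eq_one_iff.1 (h s hs)
    exact ⟨k, by simp [hk]⟩
  have h0 : (0 : ℝ) ∈ Set.Icc (0 : ℝ) 1 := by simp
  have h1 : (1 : ℝ) ∈ Set.Icc (0 : ℝ) 1 := by simp
  have key := isPreconnected_Icc.constant_of_mapsTo hdisc hre hmaps h1 h0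
  obtain ⟨k, hk⟩ := Complex.exp_eq_one_iff.1 (h 1 h1)
  obtain ⟨l, hl⟩ := Complex.exp_eq_one_iff.1 (h 0 h0)
  simp only [hk, hl, mul_div_cancel_right₀ _ hpi, Complex.intCast_re, Int.cast_inj] at key
  rw [hk, hl, key]

/-- Theorem 3.1(ii),(iii) for `G = ℤ`: if `μ̂` is nonvanishing with nonzero
winding number `w`, `m, n` are coprime and `ν̂ⁿ = μ̂ᵐ`, then `ν̂` is
nonvanishing, its winding number `wν` satisfies `n·wν = m·w`, and consequently
`m/n = wν/w ∈ {k/|w| : k ∈ ℕ, k > 0}` and `m/n ≥ 1/|w|`. -/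
theorem winding_number_ratio (μ : Measure ℤ) [IsProbabilityMeasure μ]
    (hnz : ∀ z : Circle, charFunZ μ z ≠ 0)
    (φ : ℝ → ℂ) (hφc : ContinuousOn φ (Set.Icc 0 1)) (hφ0 : φ 0 = 0)
    (hφ : ∀ s ∈ Set.Icc (0 : ℝ) 1,
      charFunZ μ (Circle.exp (2 * Real.pi * s)) = Complex.exp (φ s))
    (w : ℤ) (hw : φ 1 - φ 0 = 2 * Real.pi * Complex.I * w) (hw0 : w ≠ 0)
    (m n : ℕ) (hm : 0 < m) (hn : 0 < n) (hmn : Nat.Coprime m n)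
    (ν : Measure ℤ) [IsProbabilityMeasure ν]
    (hν : ∀ z, (charFunZ ν z) ^ n = (charFunZ μ z) ^ m) :
    (∀ z : Circle, charFunZ ν z ≠ 0) ∧
      ∀ (φν : ℝ → ℂ) (wν : ℤ), ContinuousOn φν (Set.Icc 0 1) → φν 0 = 0 →
        (∀ s ∈ Set.Icc (0 : ℝ) 1,
          charFunZ ν (Circle.exp (2 * Real.pi * s)) = Complex.exp (φν s)) →
        φν 1 - φν 0 = 2 * Real.pi * Complex.I * wν →
        (n : ℤ) * wν = (m : ℤ) * w ∧
          (m : ℚ) / n = (wν : ℚ) / w ∧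
          (∃ k : ℕ, 0 < k ∧ (m : ℚ) / n = (k : ℚ) / |(w : ℚ)|) ∧
          (m : ℚ) / n ≥ 1 / |(w : ℚ)| := by
  refine ⟨fun z hz => pow_ne_zero m (hnz z) ?_, ?_⟩
  · rw [← hν z, hz, zero_pow hn.ne']
  intro φν wν hc h0 hφν hwν
  have hconst : (n : ℂ) * φν 1 - m * φ 1 = n * φν 0 - m * φ 0 := by
    refine eq_of_continuousOn_of_exp_eq_one (g := fun s => (n : ℂ) * φν s - m * φ s)
      ((hc.const_mul _).sub (hφc.const_mul _)) fun s hs => ?_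
    rw [Complex.exp_sub, Complex.exp_nat_mul, Complex.exp_nat_mul, ← hφν s hs, ← hφ s hs, hν]
    exact div_self (pow_ne_zero m (hnz _))
  have hwind : (n : ℤ) * wν = (m : ℤ) * w := by
    have : (n : ℂ) * wν = m * w := by
      apply mul_left_cancel₀ Complex.two_pi_I_ne_zero
      linear_combination hconst - (n : ℂ) * hwν + (m : ℂ) * hw
    exact_mod_cast this
  have hnQ : (0 : ℚ) < n := by exact_mod_cast hn
  have hmQ : (0 : ℚ) < m := by exact_mod_cast hm
  have hwQ : (w : ℚ) ≠ 0 := by exact_mod_cast hw0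
  have hratio : (m : ℚ) / n = (wν : ℚ) / w := by
    rw [div_eq_div_iff hnQ.ne' hwQ, mul_comm (wν : ℚ)]
    exact_mod_cast hwind.symm
  have habs : (m : ℚ) / n = (wν.natAbs : ℚ) / |(w : ℚ)| := by
    rw [Nat.cast_natAbs, Int.cast_abs, ← abs_div, ← hratio, abs_of_pos (div_pos hmQ hnQ)]
  have hpos : 0 < wν.natAbs := by
    rw [Int.natAbs_pos]
    rintro rfl
    simp only [Int.cast_zero, zero_div] at hratio
    exact (div_pos hmQ hnQ).ne' hratio
  refine ⟨hwind, hratio, ⟨wν.natAbs, hpos, habs⟩, ?_⟩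
  rw [habs, ge_iff_le]
  gcongr
  exact_mod_cast hpos
end

section
/- Let μ be a probability measure on ℝ whose characteristic function μ̂ is three times continuously differentiable in a neighborhood of 0, let γ₀ ∈ ℝ with μ̂(γ₀) = 0, and let α : (−1,1) → ℝ be a smooth path with α(0) = γ₀. Then limsup_{s→0⁺} |μ̂(α(s))|/s ≤ √(−(d²/ds²)|_{s=0} Re μ̂(α(s) − γ₀)), and in particular this limsup is finite. -/
open MeasureTheory

open Filter Topology

/-- The map `x ↦ exp (i y x)` is integrable for any finite measure. -/
lemma integrable_exp_I_mul_mul (μ : Measure ℝ) [IsFiniteMeasure μ] (y : ℝ) :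
    Integrable (fun x : ℝ => Complex.exp (Complex.I * y * x)) μ := by
  refine Integrable.of_bound (by fun_prop) 1 (ae_of_all _ fun x => ?_)
  rw [show Complex.I * y * x = ((y * x : ℝ) : ℂ) * Complex.I by push_cast; ring,
    Complex.norm_exp_ofReal_mul_I]

/-- The squared length of a chord of the unit circle. -/
lemma norm_exp_I_mul_sub_exp_I_mul_sq (a b x : ℝ) :
    ‖Complex.exp (Complex.I * a * x) - Complex.exp (Complex.I * b * x)‖ ^ 2 =
      2 * (1 - (Complex.exp (Complex.I * (a - b : ℝ) * x)).re) := by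
  have key (y : ℝ) : Complex.I * y * x = ((y * x : ℝ) : ℂ) * Complex.I := by push_cast; ring
  rw [key, key, key, ← Complex.normSq_eq_norm_sq, Complex.normSq_apply]
  simp only [Complex.sub_re, Complex.sub_im, Complex.exp_ofReal_mul_I_re,
    Complex.exp_ofReal_mul_I_im, sub_mul, Real.cos_sub]
  linear_combination Real.sin_sq_add_cos_sq (a * x) + Real.sin_sq_add_cos_sq (b * x)

/-- The increments of a characteristic function are controlled by its real part near `0`. -/
lemma norm_charFunR_sub_sq_le (μ : Measure ℝ) [IsProbabilityMeasure μ] (a b : ℝ) :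
    ‖charFunR μ a - charFunR μ b‖ ^ 2 ≤ 2 * (1 - (charFunR μ (a - b)).re) := by
  set X : ℝ → ℝ := fun x =>
    ‖Complex.exp (Complex.I * a * x) - Complex.exp (Complex.I * b * x)‖ with hX
  have hexp := integrable_exp_I_mul_mul μ
  have hXsq : ∫ x, X x ^ 2 ∂μ = 2 * (1 - (charFunR μ (a - b)).re) := by
    simp only [hX, norm_exp_I_mul_sub_exp_I_mul_sq]
    have hre_int : Integrable
        (fun x : ℝ => (Complex.exp (Complex.I * (a - b : ℝ) * x)).re) μ := (hexp (a - b)).re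
    have hre : ∫ x : ℝ, (Complex.exp (Complex.I * (a - b : ℝ) * x)).re ∂μ =
        (charFunR μ (a - b)).re := integral_re (hexp (a - b))
    rw [integral_const_mul, integral_sub (integrable_const _) hre_int, hre]
    simp
  have hX2 : MemLp X 2 μ := by
    refine MemLp.of_bound (by fun_prop) 2 (ae_of_all _ fun x => ?_)
    rw [hX, norm_norm]
    refine (norm_sub_le _ _).trans ?_
    have key (y : ℝ) : Complex.I * y * x = ((y * x : ℝ) : ℂ) * Complex.I := by push_cast; ring
    rw [key, key, Complex.norm_exp_ofReal_mul_I, Complex.norm_exp_ofReal_mul_I]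
    norm_num
  have hle : ‖charFunR μ a - charFunR μ b‖ ≤ ∫ x, X x ∂μ := by
    rw [charFunR, charFunR, ← integral_sub (hexp a) (hexp b)]
    exact norm_integral_le_integral_norm _
  have hvar := ProbabilityTheory.variance_nonneg X μ
  rw [ProbabilityTheory.variance_eq_sub hX2] at hvar
  simp only [Pi.pow_apply, hXsq] at hvar
  have := pow_le_pow_left₀ (norm_nonneg _) hle 2
  linarith

lemma charFunR_zero (μ : Measure ℝ) [IsProbabilityMeasure μ] : charFunR μ 0 = 1 := by
  simp [charFunR]

lemma re_charFunR_le_one (μ : Measure ℝ) [IsProbabilityMeasure μ] (y : ℝ) :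
    (charFunR μ y).re ≤ 1 := by
  have h := norm_charFunR_sub_sq_le μ y 0
  rw [sub_zero] at h
  linarith [sq_nonneg ‖charFunR μ y - charFunR μ 0‖]

/-- Second-order behaviour of a `C²` function at a local maximum. -/
lemma IsLocalMax.tendsto_sub_div_sq {f : ℝ → ℝ} {x₀ : ℝ} (hmax : IsLocalMax f x₀)
    (hf : ContDiffAt ℝ 2 f x₀) :
    Tendsto (fun x => (f x₀ - f x) / (x - x₀) ^ 2) (𝓝[≠] x₀)
      (𝓝 (-(iteratedDeriv 2 f x₀) / 2)) := by
  obtain ⟨u, hu, hfu⟩ := hf.contDiffOn (m := 2) le_rfl (by simp)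
  obtain ⟨ε, hε, hεu⟩ := Metric.mem_nhds_iff.mp hu
  have hx₀ := Metric.mem_ball_self (x := x₀) hε
  have hT := taylor_tendsto (n := 2) (convex_ball x₀ ε) hx₀
    (by exact_mod_cast hfu.mono hεu)
  rw [Metric.isOpen_ball.nhdsWithin_eq hx₀] at hT
  have h1 : iteratedDerivWithin 1 f (Metric.ball x₀ ε) x₀ = 0 := by
    rw [iteratedDerivWithin_of_isOpen Metric.isOpen_ball hx₀, iteratedDeriv_one,
      hmax.deriv_eq_zero]
  have h2 := iteratedDerivWithin_of_isOpen (n := 2) (f := f) Metric.isOpen_ball hx₀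
  have hlim := (hT.mono_left (nhdsWithin_le_nhds (s := {x₀}ᶜ))).const_sub
    (-(iteratedDeriv 2 f x₀) / 2)
  rw [sub_zero] at hlim
  refine hlim.congr' ?_
  filter_upwards [self_mem_nhdsWithin] with x hx
  have hx' : x - x₀ ≠ 0 := sub_ne_zero.mpr hx
  simp only [taylorWithinEval_succ, taylor_within_zero_eval, zero_add, h1, Nat.reduceAdd, h2,
    smul_eq_mul]
  norm_num
  field_simp
  ring

/-- If `μ̂` is `C³` near `0`, `μ̂ γ₀ = 0` and `α` is a smooth path with
`α 0 = γ₀`, then `limsup_{s→0⁺} |μ̂(α(s))|/s ≤ √(−(d²/ds²)|₀ Re μ̂(α(s)−γ₀))`;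
in particular this limsup is finite (the inequality is stated in `EReal`). -/
theorem limsup_charFun_along_path_le (μ : Measure ℝ) [IsProbabilityMeasure μ]
    (U : Set ℝ) (hU : U ∈ nhds (0 : ℝ)) (hC3 : ContDiffOn ℝ 3 (charFunR μ) U)
    (γ₀ : ℝ) (hγ₀ : charFunR μ γ₀ = 0)
    (α : ℝ → ℝ) (hα : ContDiffOn ℝ (⊤ : ℕ∞) α (Set.Ioo (-1 : ℝ) 1)) (hα0 : α 0 = γ₀) :
    Filter.limsup (fun s : ℝ => ((‖charFunR μ (α s)‖ / s : ℝ) : EReal))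
        (nhdsWithin 0 (Set.Ioi 0)) ≤
      ((Real.sqrt (-(iteratedDeriv 2
        (fun s => (charFunR μ (α s - γ₀)).re) 0)) : ℝ) : EReal) := by
  set h : ℝ → ℝ := fun s => (charFunR μ (α s - γ₀)).re with hh
  have h0 : h 0 = 1 := by simp [hh, hα0, charFunR_zero]
  have hmax : IsLocalMax h 0 :=
    Eventually.of_forall fun s => h0.symm ▸ re_charFunR_le_one μ _
  have hC2 : ContDiffAt ℝ 2 h 0 := by
    have hαat : ContDiffAt ℝ 2 (fun s => α s - γ₀) 0 :=
      ((hα.contDiffAt (Ioo_mem_nhds (by norm_num) (by norm_num))).of_le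
        (WithTop.coe_le_coe.mpr (le_top (a := (2 : ℕ∞))))).sub contDiffAt_const
    have hφ : ContDiffAt ℝ 2 (charFunR μ) (α 0 - γ₀) := by
      rw [hα0, sub_self]
      exact (hC3.contDiffAt hU).of_le (by norm_num)
    have hcomp : ContDiffAt ℝ 2 (charFunR μ ∘ fun s => α s - γ₀) 0 := hφ.comp 0 hαat
    exact Complex.reCLM.contDiff.contDiffAt.comp 0 hcomp
  have hlim : Tendsto (fun s => √(2 * ((h 0 - h s) / (s - 0) ^ 2))) (𝓝[>] 0)
      (𝓝 √(-(iteratedDeriv 2 h 0))) := by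
    have := ((hmax.tendsto_sub_div_sq hC2).mono_left
      (nhdsWithin_mono 0 fun s (hs : 0 < s) => hs.ne')).const_mul 2
    rw [mul_div_cancel₀ _ two_ne_zero] at this
    exact this.sqrt
  rw [← ((continuous_coe_real_ereal.tendsto _).comp hlim).limsup_eq]
  refine limsup_le_limsup ?_
  filter_upwards [self_mem_nhdsWithin] with s hs
  have hs : 0 < s := hs
  refine EReal.coe_le_coe_iff.mpr (Real.le_sqrt_of_sq_le ?_)
  have hle := norm_charFunR_sub_sq_le μ (α s) γ₀
  rw [hγ₀, sub_zero] at hle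
  rw [h0, sub_zero, div_pow, ← mul_div_assoc]
  gcongr
end

section
/- Let 𝕋 = {z ∈ ℂ : |z| = 1} be the circle group (under multiplication) and let n be a positive integer. A probability measure ν on 𝕋 satisfies ν * ⋯ * ν (n times) = δ₁ (the Dirac measure at the identity 1 ∈ 𝕋) if and only if ν = δ_ζ for some ζ ∈ 𝕋 with ζⁿ = 1. In particular, δ₁ has exactly n distinct n-th convolution roots on 𝕋. -/
open MeasureTheory

noncomputable instance : MeasurableSpace Circle := borel Circle

instance : BorelSpace Circle := ⟨rfl⟩

/-- The `n`-fold (multiplicative) convolution power of a measure on the circle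
group, with the convention that the `0`-th power is `δ₁`. -/
noncomputable def mconvPow (ν : Measure Circle) : ℕ → Measure Circle
  | 0 => Measure.dirac 1
  | k + 1 => (mconvPow ν k).mconv ν

/-- A probability measure concentrated at a point is the Dirac measure there. -/
lemma MeasureTheory.Measure.eq_dirac_of_ae_eq {α : Type*} [MeasurableSpace α] {ν : Measure α}
    [IsProbabilityMeasure ν] {b : α} (h : ∀ᵐ y ∂ν, y = b) : ν = Measure.dirac b := by
  calc ν = ν.map id := Measure.map_id.symm
    _ = ν.map (fun _ ↦ b) := Measure.map_congr h
    _ = Measure.dirac b := by simp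

/-- A convolution factor of a Dirac measure is a Dirac measure. -/
lemma MeasureTheory.Measure.exists_eq_dirac_of_mconv_eq_dirac {G : Type*} [Group G]
    [MeasurableSpace G] [MeasurableMul₂ G] [MeasurableSingletonClass G] {μ ν : Measure G}
    [IsProbabilityMeasure μ] [IsProbabilityMeasure ν] {a : G}
    (h : μ.mconv ν = Measure.dirac a) : ∃ b, ν = Measure.dirac b := by
  have hae : ∀ᵐ z ∂(μ.mconv ν), z = a := by
    rw [h, ae_dirac_eq]
    exact Filter.eventually_pure.mpr rfl
  have hprod : ∀ᵐ p ∂(μ.prod ν), p.1 * p.2 = a :=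
    ae_of_ae_map measurable_mul.aemeasurable hae
  obtain ⟨x, hx⟩ := (Measure.ae_ae_of_ae_prod hprod).exists
  exact ⟨x⁻¹ * a, eq_dirac_of_ae_eq <| hx.mono fun y hy ↦ eq_inv_mul_of_mul_eq hy⟩

lemma isProbabilityMeasure_mconvPow (ν : Measure Circle) [IsProbabilityMeasure ν] (n : ℕ) :
    IsProbabilityMeasure (mconvPow ν n) := by
  induction n with
  | zero => exact Measure.dirac.isProbabilityMeasure
  | succ k ih => exact Measure.probabilitymeasure_of_probabilitymeasures_mconv _ _

lemma mconvPow_dirac (ζ : Circle) (n : ℕ) :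
    mconvPow (Measure.dirac ζ) n = Measure.dirac (ζ ^ n) := by
  induction n with
  | zero => rw [pow_zero, mconvPow]
  | succ k ih => rw [mconvPow, ih, Measure.dirac_mconv_dirac, pow_succ]

lemma mconvPow_eq_dirac_one_iff {n : ℕ} (hn : 0 < n) (ν : Measure Circle)
    [IsProbabilityMeasure ν] :
    mconvPow ν n = Measure.dirac 1 ↔ ∃ ζ : Circle, ζ ^ n = 1 ∧ ν = Measure.dirac ζ := by
  constructor
  · intro h
    obtain ⟨ζ, rfl⟩ : ∃ ζ, ν = Measure.dirac ζ := by
      obtain ⟨k, rfl⟩ := Nat.exists_eq_add_one.mpr hn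
      have := isProbabilityMeasure_mconvPow ν k
      rw [mconvPow] at h
      exact Measure.exists_eq_dirac_of_mconv_eq_dirac h
    rw [mconvPow_dirac, dirac_eq_dirac_iff] at h
    exact ⟨ζ, h, rfl⟩
  · rintro ⟨ζ, hζ, rfl⟩
    rw [mconvPow_dirac, hζ]

lemma Circle.ncard_pow_eq_one {n : ℕ} (hn : 0 < n) : {ζ : Circle | ζ ^ n = 1}.ncard = n := by
  have : NeZero n := ⟨hn.ne'⟩
  have himage : {ζ : Circle | ζ ^ n = 1} =
      (Units.val : Circleˣ → Circle) '' (rootsOfUnity n Circle : Set Circleˣ) := by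
    ext ζ
    refine ⟨fun h ↦ ⟨_root_.toUnits ζ, ?_, rfl⟩, ?_⟩
    · rw [SetLike.mem_coe, mem_rootsOfUnity']
      exact h
    · rintro ⟨u, hu, rfl⟩
      exact (mem_rootsOfUnity' n u).mp hu
  rw [himage, Set.ncard_image_of_injective _ Units.val_injective, ← Nat.card_coe_set_eq]
  exact HasEnoughRootsOfUnity.natCard_rootsOfUnity Circle n

/-- On the circle group `𝕋`, a probability measure `ν` satisfies
`ν ∗ ⋯ ∗ ν (n times) = δ₁` iff `ν = δ_ζ` for some `n`-th root of unity `ζ`;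
in particular `δ₁` has exactly `n` distinct `n`-th convolution roots. -/
theorem circle_conv_roots_of_dirac_one (n : ℕ) (hn : 0 < n) :
    (∀ ν : Measure Circle, IsProbabilityMeasure ν →
      (mconvPow ν n = Measure.dirac 1 ↔
        ∃ ζ : Circle, ζ ^ n = 1 ∧ ν = Measure.dirac ζ)) ∧
      {ν : Measure Circle | IsProbabilityMeasure ν ∧
        mconvPow ν n = Measure.dirac 1}.ncard = n := by
  refine ⟨fun ν _ ↦ mconvPow_eq_dirac_one_iff hn ν, ?_⟩
  have himage : {ν : Measure Circle | IsProbabilityMeasure ν ∧ mconvPow ν n = Measure.dirac 1} =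
      (fun ζ ↦ Measure.dirac ζ) '' {ζ : Circle | ζ ^ n = 1} := by
    ext ν
    constructor
    · rintro ⟨_, h⟩
      obtain ⟨ζ, hζ, rfl⟩ := (mconvPow_eq_dirac_one_iff hn ν).mp h
      exact ⟨ζ, hζ, rfl⟩
    · rintro ⟨ζ, hζ, rfl⟩
      exact ⟨Measure.dirac.isProbabilityMeasure,
        (mconvPow_eq_dirac_one_iff hn _).mpr ⟨ζ, hζ, rfl⟩⟩
  rw [himage, Set.ncard_image_of_injective _ injective_dirac, Circle.ncard_pow_eq_one hn]
end
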